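/- For every integer n ≥ 1, the double sum U_2 satisfies the recurrence U_2(n+2) = q^{6n+8} U_2(n) in ℚ(q). -/

import Mathlib

open Finset

noncomputable def q : RatFunc ℚ := RatFunc.X

noncomputable def qPoch (a : RatFunc ℚ) (n : ℕ) : RatFunc ℚ :=
  ∏ k ∈ Finset.range n, (1 - a * q ^ k)

noncomputable def qPochZ (a : RatFunc ℚ) (n : ℤ) : RatFunc ℚ :=
  if 0 ≤ n then qPoch a n.toNat else 1 / qPoch (a * q ^ n) (-n).toNat

noncomputable def qbinom (n m : ℤ) : RatFunc ℚ :=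
  if 0 ≤ m ∧ m ≤ n then
    qPoch q n.toNat / (qPoch q m.toNat * qPoch q (n - m).toNat)
  else 0

/-- The multiple sum `U_m(n)`, with the cyclic convention `r_{m+1} = r_1`. -/
noncomputable def Umul (m : ℕ) [NeZero m] (n : ℕ) : RatFunc ℚ :=
  ∑ r ∈ Fintype.piFinset (fun _ : Fin m => Finset.range (2 * n + 2)),
    ∏ k : Fin m,
      ((-1 : RatFunc ℚ) ^ r k * q ^ (r k * (r k - 1) / 2) *
        qPochZ (-q) ((n : ℤ) - r k) * qbinom (2 * (n : ℤ) - r k + 1) (r (k + 1)))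

/-- The multiple sum `W_m(n)`, with the cyclic convention `r_{m+1} = r_1`. -/
noncomputable def Wmul (m : ℕ) [NeZero m] (n : ℕ) : RatFunc ℚ :=
  ∑ r ∈ Fintype.piFinset (fun _ : Fin m => Finset.range (2 * n + 1)),
    ∏ k : Fin m,
      ((-1 : RatFunc ℚ) ^ r k * q ^ (r k * (r k - 1) / 2) *
        qPochZ (-q) ((n : ℤ) - r k) * qbinom (2 * (n : ℤ) - r k) (r (k + 1)))

open Polynomial in
theorem q_pow_ne_one {k : ℕ} (hk : k ≠ 0) : q ^ k ≠ 1 := by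
  intro h
  have h2 : algebraMap ℚ[X] (RatFunc ℚ) (X ^ k) = algebraMap ℚ[X] (RatFunc ℚ) 1 := by
    simpa [q] using h
  have h3 := RatFunc.algebraMap_injective ℚ h2
  have h4 := congrArg Polynomial.natDegree h3
  simp at h4
  exact hk h4

theorem q_ne_zero : q ≠ 0 := RatFunc.X_ne_zero

theorem one_add_q_zpow_ne_zero (k : ℤ) : 1 + q ^ k ≠ 0 := by
  intro h
  rcases eq_or_ne k 0 with rfl | hk
  · norm_num at h
  have h1 : q ^ k = -1 := by linear_combination h
  have h2 : q ^ (2 * k) = 1 := by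
    rw [mul_comm, zpow_mul, h1]; norm_num
  rcases Int.natAbs_eq (2 * k) with h3 | h3
  · rw [h3, zpow_natCast] at h2
    exact q_pow_ne_one (by omega) h2
  · rw [h3, zpow_neg, zpow_natCast, inv_eq_one] at h2
    exact q_pow_ne_one (by omega) h2

theorem qPoch_zero (x : RatFunc ℚ) : qPoch x 0 = 1 := by simp [qPoch]

theorem qPoch_succ (x : RatFunc ℚ) (m : ℕ) :
    qPoch x (m + 1) = qPoch x m * (1 - x * q ^ m) := by
  simp [qPoch, Finset.prod_range_succ]

theorem qPoch_add (x : RatFunc ℚ) (m k : ℕ) :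
    qPoch x (m + k) = qPoch x m * qPoch (x * q ^ m) k := by
  simp only [qPoch, Finset.prod_range_add, pow_add, mul_assoc]

theorem qPoch_succ' (x : RatFunc ℚ) (m : ℕ) :
    qPoch x (m + 1) = (1 - x) * qPoch (x * q) m := by
  rw [add_comm, qPoch_add]
  simp [qPoch]

theorem qPoch_q_ne_zero (m : ℕ) : qPoch q m ≠ 0 := by
  refine Finset.prod_ne_zero_iff.mpr fun k _ h => q_pow_ne_one k.succ_ne_zero ?_
  rw [pow_succ']
  linear_combination -h

theorem qPoch_neg_zpow_ne_zero (k : ℤ) (m : ℕ) : qPoch (-q ^ k) m ≠ 0 := by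
  refine Finset.prod_ne_zero_iff.mpr fun j _ h => one_add_q_zpow_ne_zero (k + j) ?_
  rw [zpow_add₀ q_ne_zero, zpow_natCast]
  linear_combination h

theorem pow_choose_two_succ (k : ℕ) :
    q ^ (k + 1).choose 2 = q ^ k * q ^ k.choose 2 := by
  rw [Nat.choose_succ_succ' k 1, Nat.choose_one_right, pow_add]

/-- Reversal of the order of the factors of a `q`-shifted factorial. -/
theorem qPoch_reverse (m : ℕ) (x y : RatFunc ℚ) (hxy : x * y * q ^ m = q) :
    qPoch x m = (-x) ^ m * q ^ m.choose 2 * qPoch y m := by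
  induction m generalizing y with
  | zero => simp [qPoch]
  | succ m ih =>
    have hq := q_ne_zero
    have h1 : x * y * q ^ m = 1 := by
      apply mul_right_cancel₀ hq
      rw [pow_succ] at hxy
      linear_combination hxy
    rw [qPoch_succ, qPoch_succ', pow_choose_two_succ, ih (y * q) (by linear_combination q * h1)]
    linear_combination -(-x) ^ m * q ^ m.choose 2 * qPoch (y * q) m * h1

/-- The Gaussian binomial coefficient, defined by the `q`-Pascal rule. -/
noncomputable def gaussBinom : ℕ → ℕ → RatFunc ℚ
  | _, 0 => 1
  | 0, _ + 1 => 0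
  | a + 1, k + 1 => gaussBinom a k + q ^ (k + 1) * gaussBinom a (k + 1)

theorem gaussBinom_zero_right (a : ℕ) : gaussBinom a 0 = 1 := by
  cases a <;> rfl

theorem gaussBinom_succ_succ (a k : ℕ) :
    gaussBinom (a + 1) (k + 1) = gaussBinom a k + q ^ (k + 1) * gaussBinom a (k + 1) := rfl

theorem gaussBinom_of_lt {a k : ℕ} (h : a < k) : gaussBinom a k = 0 := by
  induction a generalizing k with
  | zero => obtain ⟨k, rfl⟩ := Nat.exists_eq_succ_of_ne_zero h.ne'; rfl
  | succ a ih =>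
    obtain ⟨k, rfl⟩ := Nat.exists_eq_succ_of_ne_zero (by omega : k ≠ 0)
    rw [Nat.succ_eq_add_one, gaussBinom_succ_succ, ih (by omega), ih (by omega)]
    simp

theorem gaussBinom_mul_qPoch (k b : ℕ) :
    gaussBinom (k + b) k * (qPoch q k * qPoch q b) = qPoch q (k + b) := by
  induction k generalizing b with
  | zero => simp [gaussBinom_zero_right, qPoch_zero]
  | succ k ihk =>
    induction b with
    | zero =>
      have := ihk 0
      simp only [add_zero, qPoch_zero, mul_one] at this ⊢
      rw [gaussBinom_succ_succ, gaussBinom_of_lt k.lt_succ_self, qPoch_succ]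
      linear_combination (1 - q * q ^ k) * this
    | succ b ihb =>
      have h1 := ihk (b + 1)
      rw [show k + 1 + b = k + (b + 1) by ring] at ihb
      rw [show k + 1 + (b + 1) = k + (b + 1) + 1 by ring, gaussBinom_succ_succ,
        qPoch_succ q (k + (b + 1)), qPoch_succ q k]
      rw [qPoch_succ q k] at ihb
      rw [qPoch_succ q b] at h1 ⊢
      rw [show q ^ (k + (b + 1)) = q ^ k * (q * q ^ b) by ring]
      rw [show q ^ (k + 1) = q * q ^ k by ring]
      linear_combination (1 - q * q ^ k) * h1 + q * q ^ k * (1 - q * q ^ b) * ihb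

theorem qbinom_natCast (a k : ℕ) : qbinom a k = gaussBinom a k := by
  unfold qbinom
  split_ifs with h
  · obtain ⟨b, rfl⟩ := Nat.exists_eq_add_of_le (Int.ofNat_le.mp h.2)
    rw [show ((k + b : ℕ) : ℤ) - k = b by push_cast; ring]
    simp only [Int.toNat_natCast]
    rw [div_eq_iff (mul_ne_zero (qPoch_q_ne_zero k) (qPoch_q_ne_zero b)), gaussBinom_mul_qPoch]
  · rw [gaussBinom_of_lt (by omega)]

theorem sum_gaussBinom_succ (a : ℕ) (f : ℕ → RatFunc ℚ) :
    ∑ k ∈ range (a + 2), gaussBinom (a + 1) k * f k =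
      ∑ k ∈ range (a + 1), gaussBinom a k * (f (k + 1) + q ^ k * f k) := by
  have h : ∑ k ∈ range (a + 1), gaussBinom a k * (q ^ k * f k) =
      ∑ k ∈ range (a + 1), gaussBinom a (k + 1) * (q ^ (k + 1) * f (k + 1)) + f 0 := by
    have h1 := Finset.sum_range_succ (fun k => gaussBinom a k * (q ^ k * f k)) (a + 1)
    rw [gaussBinom_of_lt a.lt_succ_self, Finset.sum_range_succ'] at h1
    simpa [gaussBinom_zero_right] using h1.symm
  simp only [mul_add, Finset.sum_add_distrib]
  rw [h, Finset.sum_range_succ', gaussBinom_zero_right, one_mul, ← add_assoc,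
    ← Finset.sum_add_distrib]
  congr 1
  refine Finset.sum_congr rfl fun k _ => ?_
  rw [gaussBinom_succ_succ]
  ring

theorem sum_gaussBinom_extend {a m : ℕ} (h : a < m) (f : ℕ → RatFunc ℚ) :
    ∑ k ∈ range m, gaussBinom a k * f k = ∑ k ∈ range (a + 1), gaussBinom a k * f k := by
  symm
  refine Finset.sum_subset (Finset.range_mono h) fun k _ hk => ?_
  rw [gaussBinom_of_lt (by simpa using hk), zero_mul]

/-- A terminating case of the `₁φ₁` summation. -/
theorem sum_gaussBinom_mul_qPoch (a : ℕ) (x : RatFunc ℚ) :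
    ∑ k ∈ range (a + 1),
      gaussBinom a k * (x ^ k * (q ^ k.choose 2) ^ 2 * qPoch (x * q ^ k) (a - k)) = 1 := by
  induction a generalizing x with
  | zero => simp [gaussBinom_zero_right, qPoch_zero]
  | succ a ih =>
    rw [sum_gaussBinom_succ, ← ih (x * q)]
    refine Finset.sum_congr rfl fun k hk => ?_
    obtain ⟨b, rfl⟩ := Nat.exists_eq_add_of_le (Nat.lt_succ_iff.mp (Finset.mem_range.mp hk))
    rw [show k + b + 1 - (k + 1) = b by omega, show k + b + 1 - k = b + 1 by omega,
      Nat.add_sub_cancel_left, qPoch_succ', pow_choose_two_succ,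
      show x * q ^ (k + 1) = x * q * q ^ k by ring, show x * q ^ k * q = x * q * q ^ k by ring]
    ring

/-- The `q`-Chu–Vandermonde sum, cleared of denominators. -/
theorem sum_gaussBinom_chu_vandermonde (a : ℕ) (c z : RatFunc ℚ) :
    ∑ k ∈ range (a + 1),
      gaussBinom a k * ((-1) ^ k * q ^ k.choose 2 * (∏ j ∈ range k, (z - c * q ^ j)) *
        qPoch (c * q ^ k) (a - k)) = qPoch z a := by
  induction a generalizing c z with
  | zero => simp [gaussBinom_zero_right, qPoch_zero]
  | succ a ih =>
    rw [sum_gaussBinom_succ, qPoch_succ', ← ih (c * q) (z * q), Finset.mul_sum]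
    refine Finset.sum_congr rfl fun k hk => ?_
    obtain ⟨b, rfl⟩ := Nat.exists_eq_add_of_le (Nat.lt_succ_iff.mp (Finset.mem_range.mp hk))
    have h : ∏ j ∈ range k, (z * q - c * q * q ^ j) =
        q ^ k * ∏ j ∈ range k, (z - c * q ^ j) := by
      rw [Finset.prod_congr rfl fun j _ =>
        show z * q - c * q * q ^ j = q * (z - c * q ^ j) by ring, Finset.prod_mul_distrib]
      simp
    rw [show k + b + 1 - (k + 1) = b by omega, show k + b + 1 - k = b + 1 by omega,
      Nat.add_sub_cancel_left, qPoch_succ', pow_choose_two_succ, h, Finset.prod_range_succ,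
      show c * q ^ (k + 1) = c * q * q ^ k by ring, show c * q ^ k * q = c * q * q ^ k by ring]
    ring

theorem qPochZ_neg_q_sub (n r : ℕ) :
    qPochZ (-q) ((n : ℤ) - r) =
      qPoch (-q) n * (q ^ r.choose 2 / (q ^ (n * r) * qPoch (-q ^ (-n : ℤ)) r)) := by
  have hq := q_ne_zero
  have h1 : qPochZ (-q) ((n : ℤ) - r) * qPoch (-q ^ (1 + n - r : ℤ)) r = qPoch (-q) n := by
    unfold qPochZ
    split_ifs with h
    · obtain ⟨b, rfl⟩ := Nat.exists_eq_add_of_le (show r ≤ n by omega)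
      rw [show (((r + b : ℕ) : ℤ) - r) = b by push_cast; ring, Int.toNat_natCast,
        show (1 + (r + b : ℕ) - r : ℤ) = ((b + 1 : ℕ) : ℤ) by push_cast; ring, zpow_natCast,
        add_comm r b, qPoch_add, show -q * q ^ b = -q ^ (b + 1) by ring]
    · obtain ⟨b, rfl⟩ := Nat.exists_eq_add_of_le (show n ≤ r by omega)
      have hx : -q * q ^ ((n : ℤ) - (n + b : ℕ)) = -q ^ (1 + n - (n + b : ℕ) : ℤ) := by
        rw [add_sub_assoc, zpow_add₀ hq, zpow_one, neg_mul]
      have hb : -q ^ (1 + n - (n + b : ℕ) : ℤ) * q ^ b = -q := by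
        rw [← zpow_natCast, neg_mul, ← zpow_add₀ hq,
          show (1 + n - (n + b : ℕ) + b : ℤ) = 1 by push_cast; ring, zpow_one]
      rw [hx, show (-((n : ℤ) - (n + b : ℕ))).toNat = b by omega, add_comm n b, qPoch_add,
        ← add_comm n b, hb]
      field_simp [qPoch_neg_zpow_ne_zero]
  have h2 := qPoch_reverse r (-q ^ (1 + n - r : ℤ)) (-q ^ (-n : ℤ)) (by
    rw [neg_mul_neg, ← zpow_natCast, ← zpow_add₀ hq, ← zpow_add₀ hq,
      show (1 + n - r + -n + r : ℤ) = 1 by ring, zpow_one])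
  have h3 : (- -q ^ (1 + n - r : ℤ)) ^ r * q ^ r.choose 2 * q ^ r.choose 2 = q ^ (n * r) := by
    rw [neg_neg, mul_assoc, ← pow_add, ← mul_two, Nat.choose_two_right,
      Nat.div_mul_cancel (Nat.even_mul_pred_self r).two_dvd]
    simp only [← zpow_natCast, ← zpow_mul, ← zpow_add₀ hq]
    congr 1
    cases r
    · simp
    · rw [Nat.add_sub_cancel]
      push_cast
      ring
  rw [← h1, mul_assoc, h2, ← h3]
  have h4 : qPoch (-q ^ (-n : ℤ)) r ≠ 0 := qPoch_neg_zpow_ne_zero _ _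
  have h5 : (- -q ^ (1 + n - r : ℤ)) ≠ 0 := by
    rw [neg_neg]; exact zpow_ne_zero _ hq
  generalize - -q ^ (1 + n - r : ℤ) = y at *
  field_simp

/-- The kernel matrix whose square has trace `Umul 2 n`. -/
noncomputable def kernelMatrix (n : ℕ) : Matrix (Fin (2 * n + 2)) (Fin (2 * n + 2)) (RatFunc ℚ) :=
  fun r s => (-1) ^ (r : ℕ) * q ^ (r : ℕ).choose 2 * qPochZ (-q) ((n : ℤ) - (r : ℕ)) *
    gaussBinom (2 * n + 1 - r) s

theorem Umul_two_eq_trace (n : ℕ) :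
    Umul 2 n = (kernelMatrix n * kernelMatrix n).trace := by
  have h : ∀ r ∈ range (2 * n + 2), ∀ s : ℕ,
      qbinom (2 * (n : ℤ) - r + 1) s = gaussBinom (2 * n + 1 - r) s := by
    intro r hr s
    rw [← qbinom_natCast, Nat.cast_sub (Nat.lt_succ_iff.mp (Finset.mem_range.mp hr))]
    congr 1
    push_cast
    ring
  unfold Umul
  simp only [Matrix.trace, Matrix.diag_apply, Matrix.mul_apply, kernelMatrix]
  have hsum : ∀ f : ℕ → ℕ → RatFunc ℚ, ∑ r : Fin (2 * n + 2), ∑ s : Fin (2 * n + 2), f r s =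
      ∑ p ∈ range (2 * n + 2) ×ˢ range (2 * n + 2), f p.1 p.2 := fun f => by
    simp [Finset.sum_product, Finset.sum_range]
  rw [hsum (fun r s =>
    ((-1) ^ r * q ^ r.choose 2 * qPochZ (-q) ((n : ℤ) - r) * gaussBinom (2 * n + 1 - r) s) *
    ((-1) ^ s * q ^ s.choose 2 * qPochZ (-q) ((n : ℤ) - s) * gaussBinom (2 * n + 1 - s) r))]
  refine Finset.sum_nbij' (fun r => (r 0, r 1)) (fun p => ![p.1, p.2]) ?_ ?_ ?_ ?_ ?_
  · intro r hr
    rw [Fintype.mem_piFinset] at hr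
    exact Finset.mem_product.mpr ⟨hr 0, hr 1⟩
  · intro p hp
    rw [Finset.mem_product] at hp
    rw [Fintype.mem_piFinset, Fin.forall_fin_two]
    exact hp
  · intro r _
    ext k
    fin_cases k <;> rfl
  · intro p _
    rfl
  · intro r hr
    rw [Fintype.mem_piFinset] at hr
    rw [Fin.prod_univ_two, h _ (hr 0), h _ (hr 1), ← Nat.choose_two_right, ← Nat.choose_two_right]
    rfl

theorem neg_zpow_sq_mul (n : ℕ) : (-q ^ (-n : ℤ)) ^ 2 * q ^ (2 * n) = 1 := by
  have := q_ne_zero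
  rw [zpow_neg, zpow_natCast, mul_comm 2 n, pow_mul]
  field_simp

/-- The weight `(-1)^r q^(r(r-1)/2) (-q;q)_{n-r}` in terms of `c = -q^{-n}`. -/
theorem weight_eq (n r : ℕ) :
    (-1) ^ r * q ^ r.choose 2 * qPochZ (-q) ((n : ℤ) - r) =
      qPoch (-q) n * ((-q ^ (-n : ℤ)) ^ r * (q ^ r.choose 2) ^ 2 / qPoch (-q ^ (-n : ℤ)) r) := by
  have := q_ne_zero
  have h : (-q ^ (-n : ℤ)) ^ r = (-1) ^ r / q ^ (n * r) := by
    rw [zpow_neg, zpow_natCast, pow_mul, neg_pow, inv_pow, div_eq_mul_inv]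
  rw [qPochZ_neg_q_sub, h]
  field_simp

/-- The values at `x` of the basis polynomials on which the kernel matrix acts. -/
noncomputable def testVec (N : ℕ) (x : RatFunc ℚ) (s : ℕ) : RatFunc ℚ :=
  x ^ s * (q ^ s.choose 2) ^ 2 * qPoch (x * q ^ s) (N - s)

theorem sum_gaussBinom_testVec {N a : ℕ} (ha : a ≤ N) (x : RatFunc ℚ) :
    ∑ s ∈ range (N + 1), gaussBinom a s * testVec N x s = qPoch (x * q ^ a) (N - a) := by
  rw [sum_gaussBinom_extend (by omega), ← one_mul (qPoch _ _), ← sum_gaussBinom_mul_qPoch a x,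
    Finset.sum_mul]
  refine Finset.sum_congr rfl fun k hk => ?_
  obtain ⟨b, rfl⟩ := Nat.exists_eq_add_of_le (Nat.lt_succ_iff.mp (Finset.mem_range.mp hk))
  obtain ⟨d, rfl⟩ := Nat.exists_eq_add_of_le ha
  rw [testVec, show k + b + d - k = b + d by omega, qPoch_add, Nat.add_sub_cancel_left,
    Nat.add_sub_cancel_left, show x * q ^ k * q ^ b = x * q ^ (k + b) by ring]
  ring

theorem qPoch_mul_pow_sub {N : ℕ} (c z : RatFunc ℚ) (hc : c ^ 2 * q ^ N = q) {s : ℕ}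
    (hs : s ≤ N) :
    c ^ s * q ^ s.choose 2 * qPoch (c * z * q ^ (N - s)) s =
      (-1) ^ s * ∏ j ∈ range s, (z - c * q ^ j) := by
  induction s with
  | zero => simp [qPoch]
  | succ s ih =>
    have ih := ih (by omega)
    obtain ⟨d, rfl⟩ := Nat.exists_eq_add_of_le hs
    rw [show s + 1 + d - s = d + 1 by omega, show c * z * q ^ (d + 1) = c * z * q ^ d * q by ring]
      at ih
    have h : c ^ 2 * q ^ (s + d) = 1 := by
      apply mul_right_cancel₀ q_ne_zero
      rw [show s + 1 + d = s + d + 1 by ring] at hc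
      linear_combination hc
    rw [Nat.add_sub_cancel_left, qPoch_succ', Finset.prod_range_succ, pow_choose_two_succ]
    rw [pow_add] at h
    linear_combination c * q ^ s * (1 - c * z * q ^ d) * ih -
      z * (-1) ^ s * (∏ j ∈ range s, (z - c * q ^ j)) * h

theorem sum_kernel_testVec (n r : ℕ) (hr : r ≤ 2 * n + 1) (x : RatFunc ℚ) :
    ∑ s ∈ range (2 * n + 2),
      gaussBinom (2 * n + 1 - r) s * ((-1) ^ s * q ^ s.choose 2 * qPochZ (-q) ((n : ℤ) - s) *
        qPoch (x * q ^ (2 * n + 1 - s)) s) =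
      qPoch (-q) n * qPoch (x / (-q ^ (-n : ℤ))) (2 * n + 1 - r) /
        qPoch (-q ^ (-n : ℤ)) (2 * n + 1 - r) := by
  have hq := q_ne_zero
  have hP := fun m => qPoch_neg_zpow_ne_zero (-n) m
  have hc2 := neg_zpow_sq_mul n
  have hc0 : (-q ^ (-n : ℤ)) ≠ 0 := neg_ne_zero.mpr (zpow_ne_zero _ hq)
  simp only [weight_eq]
  generalize -q ^ (-n : ℤ) = c at *
  rw [sum_gaussBinom_extend (by omega), eq_div_iff (hP _),
    ← sum_gaussBinom_chu_vandermonde _ c (x / c), Finset.sum_mul, Finset.mul_sum]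
  refine Finset.sum_congr rfl fun s hs => ?_
  rw [Finset.mem_range] at hs
  have h1 := qPoch_mul_pow_sub c (x / c) (N := 2 * n + 1)
    (by rw [pow_succ]; linear_combination q * hc2) (s := s) (by omega)
  rw [mul_div_cancel₀ x hc0] at h1
  have h2 : qPoch c (2 * n + 1 - r) = qPoch c s * qPoch (c * q ^ s) (2 * n + 1 - r - s) := by
    rw [← qPoch_add]; congr 1; omega
  have := hP s
  rw [h2]
  generalize ∏ j ∈ range s, (x / c - c * q ^ j) = y at *
  field_simp
  linear_combination gaussBinom (2 * n + 1 - r) s * qPoch (-q) n *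
    qPoch (c * q ^ s) (2 * n + 1 - r - s) * h1

theorem pow_choose_two_sq_mul (r : ℕ) : (q ^ r.choose 2) ^ 2 * q ^ r = (q ^ r) ^ r := by
  rw [← pow_mul, ← pow_add, ← pow_mul, Nat.choose_two_right,
    Nat.div_mul_cancel (Nat.even_mul_pred_self r).two_dvd]
  congr 1
  cases r
  · rfl
  · rw [Nat.add_sub_cancel]
    ring

theorem pow_choose_two_add (r b : ℕ) :
    q ^ (r + b).choose 2 = q ^ r.choose 2 * q ^ b.choose 2 * (q ^ b) ^ r := by
  induction r with
  | zero => simp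
  | succ r ih =>
    rw [show r + 1 + b = r + b + 1 by ring, pow_choose_two_succ, pow_choose_two_succ, ih]
    ring

/-- The scalar relating the square of the kernel matrix to the inversion `x ↦ c³ / x`. -/
noncomputable def inversionFactor (n : ℕ) : RatFunc ℚ :=
  -(qPoch (-q) n ^ 2 * q ^ (2 * n + 1).choose 2) /
    ((-q ^ (-n : ℤ)) ^ (2 * n + 1) * qPoch (-q ^ (-n : ℤ)) (2 * n + 1))

theorem weight_mul_qPoch (n r : ℕ) (hr : r ≤ 2 * n + 1) (x : RatFunc ℚ) (hx : x ≠ 0) :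
    (-1) ^ r * q ^ r.choose 2 * qPochZ (-q) ((n : ℤ) - r) *
      (qPoch (-q) n * qPoch (x / (-q ^ (-n : ℤ))) (2 * n + 1 - r) /
        qPoch (-q ^ (-n : ℤ)) (2 * n + 1 - r)) =
      inversionFactor n * (x ^ (2 * n + 1) *
        testVec (2 * n + 1) ((-q ^ (-n : ℤ)) ^ 3 / x) r) := by
  have hq := q_ne_zero
  have hP := fun m => qPoch_neg_zpow_ne_zero (-n) m
  have hc2 := neg_zpow_sq_mul n
  have hc0 : (-q ^ (-n : ℤ)) ≠ 0 := neg_ne_zero.mpr (zpow_ne_zero _ hq)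
  rw [weight_eq, inversionFactor, testVec]
  generalize -q ^ (-n : ℤ) = c at *
  obtain ⟨b, hb⟩ := Nat.exists_eq_add_of_le hr
  have hcq : c ^ 2 * q ^ (r + b) = q := by
    rw [← hb, pow_succ]; linear_combination q * hc2
  have hsign : (-1 : RatFunc ℚ) ^ r * (-1) ^ b = -1 := by
    rw [← pow_add, ← hb]; exact Odd.neg_one_pow ⟨n, rfl⟩
  rw [hb, Nat.add_sub_cancel_left]
  have h1 : qPoch (x / c) b =
      (-(x / c)) ^ b * q ^ b.choose 2 * qPoch (c ^ 3 / x * q ^ r) b := by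
    apply qPoch_reverse
    field_simp
    rw [pow_add] at hcq
    linear_combination hcq
  have h4 : c ^ r * q ^ r.choose 2 * ((c * q ^ b) ^ r * q ^ r.choose 2) = 1 := by
    apply mul_right_cancel₀ (pow_ne_zero r hq)
    have h7 := congrArg (· ^ r) hcq
    simp only [mul_pow, pow_add] at h7 ⊢
    linear_combination c ^ r * c ^ r * (q ^ b) ^ r * pow_choose_two_sq_mul r + h7
  have h2 : c ^ r * q ^ r.choose 2 * qPoch c (r + b) = (-1) ^ r * qPoch c r * qPoch c b := by
    have h3 : qPoch (c * q ^ b) r = (-(c * q ^ b)) ^ r * q ^ r.choose 2 * qPoch c r := by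
      apply qPoch_reverse
      rw [pow_add] at hcq
      linear_combination hcq
    rw [add_comm r b, qPoch_add, h3, neg_pow (c * q ^ b)]
    linear_combination (-1) ^ r * qPoch c r * qPoch c b * h4
  have h5 : q ^ b.choose 2 = q ^ (r + b).choose 2 * q ^ r.choose 2 * c ^ (2 * r) := by
    rw [pow_choose_two_add]
    linear_combination -q ^ b.choose 2 * h4
  have hr0 := hP r
  have hb0 := hP b
  have h6 : qPoch c (r + b) = (-1) ^ r * qPoch c r * qPoch c b / (c ^ r * q ^ r.choose 2) := by
    rw [eq_div_iff (by positivity)]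
    linear_combination h2
  rw [h1, h6, h5, neg_pow (x / c)]
  simp only [div_pow, pow_add]
  field_simp
  linear_combination qPoch (-q) n ^ 2 * c ^ (r * 3) * qPoch (c ^ 3 * q ^ r / x) b * hsign

theorem kernelMatrix_sq_testVec (n : ℕ) (r : Fin (2 * n + 2)) (x : RatFunc ℚ) (hx : x ≠ 0) :
    ∑ s, (kernelMatrix n * kernelMatrix n) r s * testVec (2 * n + 1) x s =
      inversionFactor n * (x ^ (2 * n + 1) *
        testVec (2 * n + 1) ((-q ^ (-n : ℤ)) ^ 3 / x) r) := by
  have hr : (r : ℕ) ≤ 2 * n + 1 := Nat.lt_succ_iff.mp r.2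
  have h1 : ∀ k : Fin (2 * n + 2), ∑ s, kernelMatrix n k s * testVec (2 * n + 1) x s =
      (-1) ^ (k : ℕ) * q ^ (k : ℕ).choose 2 * qPochZ (-q) ((n : ℤ) - (k : ℕ)) *
        qPoch (x * q ^ (2 * n + 1 - k)) k := by
    intro k
    have hk := sum_gaussBinom_testVec (Nat.sub_le (2 * n + 1) k) x
    rw [Nat.sub_sub_self (Nat.lt_succ_iff.mp k.2), Finset.sum_range] at hk
    rw [← hk, Finset.mul_sum]
    exact Finset.sum_congr rfl fun s _ => by rw [kernelMatrix, mul_assoc]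
  calc ∑ s, (kernelMatrix n * kernelMatrix n) r s * testVec (2 * n + 1) x s
      = ∑ k, kernelMatrix n r k * ∑ s, kernelMatrix n k s * testVec (2 * n + 1) x s := by
        simp only [Matrix.mul_apply, Finset.sum_mul, Finset.mul_sum, mul_assoc]
        exact Finset.sum_comm
    _ = _ := by
        rw [← weight_mul_qPoch n r hr x hx, ← sum_kernel_testVec n r hr x, Finset.sum_range,
          Finset.mul_sum]
        exact Finset.sum_congr rfl fun k _ => by rw [h1, kernelMatrix, mul_assoc]

open Polynomial in
/-- The polynomial whose value at `x` is `testVec N x s`. -/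
noncomputable def testPoly (N s : ℕ) : (RatFunc ℚ)[X] :=
  X ^ s * (C ((q ^ s.choose 2) ^ 2) * ∏ j ∈ range (N - s), (1 - C (q ^ (s + j)) * X))

theorem testPoly_eval (N s : ℕ) (x : RatFunc ℚ) : (testPoly N s).eval x = testVec N x s := by
  simp only [testPoly, testVec, qPoch, Polynomial.eval_mul, Polynomial.eval_pow,
    Polynomial.eval_X, Polynomial.eval_C, Polynomial.eval_prod, Polynomial.eval_sub,
    Polynomial.eval_one, mul_assoc]
  congr 2
  refine Finset.prod_congr rfl fun j _ => ?_
  rw [pow_add]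
  ring

theorem testPoly_natDegree_lt {N s : ℕ} (hs : s ≤ N) : (testPoly N s).natDegree < N + 1 := by
  have h : (∏ j ∈ range (N - s), (1 - Polynomial.C (q ^ (s + j)) * Polynomial.X)).natDegree
      ≤ N - s := by
    refine (Polynomial.natDegree_prod_le _ _).trans
      ((Finset.sum_le_card_nsmul _ _ 1 fun j _ => ?_).trans (by simp))
    compute_degree
  have h2 : (testPoly N s).natDegree ≤ s + (0 + (N - s)) :=
    Polynomial.natDegree_mul_le_of_le (Polynomial.natDegree_X_pow_le s)
      (Polynomial.natDegree_mul_le_of_le (Polynomial.natDegree_C _).le h)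
  omega

theorem testPoly_coeff_of_lt (N : ℕ) {s j : ℕ} (h : j < s) : (testPoly N s).coeff j = 0 := by
  rw [testPoly, Polynomial.coeff_X_pow_mul', if_neg (by omega)]

theorem testPoly_coeff_self (N s : ℕ) : (testPoly N s).coeff s = (q ^ s.choose 2) ^ 2 := by
  rw [testPoly, Polynomial.coeff_X_pow_mul', if_pos le_rfl, Nat.sub_self,
    Polynomial.coeff_zero_eq_eval_zero]
  simp [Polynomial.eval_prod]

/-- The coefficients of the test polynomials. -/
noncomputable def coeffMatrix (n : ℕ) : Matrix (Fin (2 * n + 2)) (Fin (2 * n + 2)) (RatFunc ℚ) :=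
  fun s j => (testPoly (2 * n + 1) s).coeff j

theorem coeffMatrix_isUnit_det (n : ℕ) : IsUnit (coeffMatrix n).det := by
  have h : (coeffMatrix n).IsUpperTriangular := fun s j h => testPoly_coeff_of_lt _ h
  rw [Matrix.det_of_isUpperTriangular h, isUnit_iff_ne_zero]
  refine Finset.prod_ne_zero_iff.mpr fun s _ => ?_
  rw [coeffMatrix, testPoly_coeff_self]
  exact pow_ne_zero _ (pow_ne_zero _ q_ne_zero)

/-- The matrix of `f(x) ↦ κ x^(2n+1) f(c³ / x)` on monomials, with `κ` the inversion factor. -/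
noncomputable def inversionMatrix (n : ℕ) :
    Matrix (Fin (2 * n + 2)) (Fin (2 * n + 2)) (RatFunc ℚ) :=
  fun i j => if (j : ℕ) = 2 * n + 1 - i then inversionFactor n * ((-q ^ (-n : ℤ)) ^ 3) ^ (i : ℕ)
    else 0

theorem inversionMatrix_trace (n : ℕ) : (inversionMatrix n).trace = 0 :=
  Finset.sum_eq_zero fun i _ => if_neg (by omega)

theorem kernelMatrix_sq_mul_coeffMatrix (n : ℕ) :
    kernelMatrix n * kernelMatrix n * coeffMatrix n = coeffMatrix n * inversionMatrix n := by
  ext r j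
  have h : ∑ s, Polynomial.C ((kernelMatrix n * kernelMatrix n) r s) * testPoly (2 * n + 1) s =
      ∑ i : Fin (2 * n + 2), Polynomial.C (coeffMatrix n r i *
        (inversionFactor n * ((-q ^ (-n : ℤ)) ^ 3) ^ (i : ℕ))) *
          Polynomial.X ^ (2 * n + 1 - i) := by
    have : Infinite (RatFunc ℚ) := Infinite.of_injective _ (algebraMap ℚ (RatFunc ℚ)).injective
    refine Polynomial.eq_of_infinite_eval_eq _ _
      ((Set.finite_singleton (0 : RatFunc ℚ)).infinite_compl.mono fun x hx => ?_)
    have hx : x ≠ 0 := hx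
    simp only [Set.mem_ofPred_eq, Polynomial.eval_finsetSum, Polynomial.eval_mul,
      Polynomial.eval_C, Polynomial.eval_pow, Polynomial.eval_X, testPoly_eval]
    rw [kernelMatrix_sq_testVec n r x hx, ← testPoly_eval,
      Polynomial.eval_eq_sum_range' (testPoly_natDegree_lt (Nat.lt_succ_iff.mp r.2)),
      Finset.sum_range, Finset.mul_sum, Finset.mul_sum]
    refine Finset.sum_congr rfl fun i _ => ?_
    have hi : x ^ (2 * n + 1) = x ^ (2 * n + 1 - i) * x ^ (i : ℕ) := by
      rw [← pow_add, Nat.sub_add_cancel (Nat.lt_succ_iff.mp i.2)]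
    rw [hi, coeffMatrix, div_pow]
    field_simp
  have hj := congrArg (fun p => Polynomial.coeff p j) h
  simp only [Polynomial.finsetSum_coeff, Polynomial.coeff_C_mul, Polynomial.coeff_X_pow] at hj
  simp only [Matrix.mul_apply (M := kernelMatrix n * kernelMatrix n),
    Matrix.mul_apply (M := coeffMatrix n)]
  refine hj.trans (Finset.sum_congr rfl fun i _ => ?_)
  rw [inversionMatrix]
  split_ifs <;> simp

theorem Umul_two_eq_zero (n : ℕ) : Umul 2 n = 0 := by
  have h := coeffMatrix_isUnit_det n
  rw [Umul_two_eq_trace, ← inversionMatrix_trace n,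
    ← Matrix.mul_nonsing_inv_cancel_right (coeffMatrix n) (kernelMatrix n * kernelMatrix n) h,
    kernelMatrix_sq_mul_coeffMatrix, Matrix.trace_mul_comm,
    Matrix.nonsing_inv_mul_cancel_left _ _ h]

/-- Lemma 3.2 (first recurrence): `U_2(n+2) = q^(6n+8) U_2(n)`. -/
theorem U2_recurrence (n : ℕ) (hn : 1 ≤ n) :
    Umul 2 (n + 2) = q ^ (6 * n + 8) * Umul 2 n := by
  rw [Umul_two_eq_zero, Umul_two_eq_zero, mul_zero]
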